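/- Let m > 0 and σ > 5/2. There exist constants C > 0 and δ > 0 such that for every ω ∈ ℂ with ω² − m² ∉ [0,∞) and 0 < |ω − m| ≤ δ, with k ∈ ℂ satisfying k² = ω² − m² and Im k > 0, the integral operator with matrix kernel K_ω(x−y) − i m(I+β)/(2k) − A₁(x−y) is bounded from L²_σ(ℝ; ℂ²) to L²_{−σ}(ℝ; ℂ²) with operator norm at most C|ω−m|^{1/2}, where K_ω(z) := −(i/2) sgn(z) α e^{ik|z|} + i(mβ + ωI) e^{ik|z|}/(2k) and A₁(z) := −(m/2)(I+β)|z| − (i/2) α sgn(z). (This expresses the low-energy expansion of the free Dirac resolvent R₀(ω) at the spectral edge ω = m: a singular term of size |ω−m|^{−1/2} with constant rank-structured kernel proportional to I+β, a bounded term A₁, and an O(|ω−m|^{1/2}) remainder in the weighted operator norm.) -/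

import Mathlib

noncomputable section

open MeasureTheory
open scoped ENNReal NNReal

/-- The Dirac matrix `α = [[-1,0],[0,1]]`. -/
def Mα : Matrix (Fin 2) (Fin 2) ℂ := !![-1, 0; 0, 1]

/-- The Dirac matrix `β = [[0,1],[1,0]]`. -/
def Mβ : Matrix (Fin 2) (Fin 2) ℂ := !![0, 1; 1, 0]

/-- The free Dirac resolvent matrix kernel
`K_ω(z) = −(i/2) sgn(z) α e^{ik|z|} + i(mβ + ωI) e^{ik|z|}/(2k)`. -/
def Kker (m : ℝ) (ω k : ℂ) (z : ℝ) : Matrix (Fin 2) (Fin 2) ℂ :=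
  (-(Complex.I / 2) * (Real.sign z : ℂ) * Complex.exp (Complex.I * k * (|z| : ℝ))) • Mα
    + (Complex.I * Complex.exp (Complex.I * k * (|z| : ℝ)) / (2 * k)) •
      ((m : ℂ) • Mβ + ω • (1 : Matrix (Fin 2) (Fin 2) ℂ))

/-- The kernel `A₁(z) = −(m/2)(I+β)|z| − (i/2)α sgn(z)`. -/
def A1ker (m : ℝ) (z : ℝ) : Matrix (Fin 2) (Fin 2) ℂ :=
  (-((m : ℂ) / 2) * (|z| : ℝ)) • ((1 : Matrix (Fin 2) (Fin 2) ℂ) + Mβ)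
    + (-(Complex.I / 2) * (Real.sign z : ℂ)) • Mα

/-- First-order Taylor bound for `exp` on the closed left half-plane. -/
lemma norm_exp_sub_one_le_of_re_nonpos {w : ℂ} (hw : w.re ≤ 0) :
    ‖Complex.exp w - 1‖ ≤ 2 * ‖w‖ := by
  rcases le_total ‖w‖ 1 with h | h
  · exact Complex.norm_exp_sub_one_le h
  · have h1 : ‖Complex.exp w‖ ≤ 1 := by rw [Complex.norm_exp]; exact Real.exp_le_one_iff.2 hw
    calc ‖Complex.exp w - 1‖ ≤ ‖Complex.exp w‖ + ‖(1 : ℂ)‖ := norm_sub_le _ _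
      _ ≤ 2 * ‖w‖ := by rw [norm_one]; linarith

/-- Second-order Taylor bound for `exp` on the closed left half-plane. -/
lemma norm_exp_sub_one_sub_id_le_of_re_nonpos {w : ℂ} (hw : w.re ≤ 0) :
    ‖Complex.exp w - 1 - w‖ ≤ 3 * ‖w‖ ^ 2 := by
  rcases le_total ‖w‖ 1 with h | h
  · exact (Complex.norm_exp_sub_one_sub_id_le h).trans (by nlinarith [sq_nonneg ‖w‖])
  · calc ‖Complex.exp w - 1 - w‖ ≤ ‖Complex.exp w - 1‖ + ‖w‖ := norm_sub_le _ _
      _ ≤ 3 * ‖w‖ ^ 2 := by nlinarith [norm_exp_sub_one_le_of_re_nonpos hw]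

/-- A combination of `α`, `I + β` and `I` acts on `ℂ²` (with the sup norm) with norm at most
`‖a‖ + 2‖b‖ + ‖c‖`. -/
lemma norm_dirac_combination_mulVec_le (a b c : ℂ) (v : Fin 2 → ℂ) :
    ‖(a • Mα + b • (1 + Mβ) + c • (1 : Matrix (Fin 2) (Fin 2) ℂ)).mulVec v‖
      ≤ (‖a‖ + 2 * ‖b‖ + ‖c‖) * ‖v‖ := by
  have h0 := norm_le_pi_norm v 0
  have h1 := norm_le_pi_norm v 1
  have key : ∀ e p q r : ℂ, ‖e‖ = ‖a‖ → ‖p‖ ≤ ‖v‖ → ‖q‖ ≤ ‖v‖ → ‖r‖ ≤ ‖v‖ →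
      ‖e * p + b * (q + r) + c * p‖ ≤ (‖a‖ + 2 * ‖b‖ + ‖c‖) * ‖v‖ := by
    intro e p q r he hp hq hr
    calc ‖e * p + b * (q + r) + c * p‖
        ≤ ‖e * p‖ + ‖b * (q + r)‖ + ‖c * p‖ := norm_add₃_le
      _ = ‖a‖ * ‖p‖ + ‖b‖ * ‖q + r‖ + ‖c‖ * ‖p‖ := by simp only [norm_mul, he]
      _ ≤ ‖a‖ * ‖v‖ + ‖b‖ * (‖v‖ + ‖v‖) + ‖c‖ * ‖v‖ := by
          gcongr
          exact (norm_add_le _ _).trans (add_le_add hq hr)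
      _ = _ := by ring
  refine (pi_norm_le_iff_of_nonneg (by positivity)).2 (Fin.forall_fin_two.2 ⟨?_, ?_⟩)
  · refine (congrArg norm ?_).trans_le (key (-a) (v 0) (v 0) (v 1) (norm_neg a) h0 h0 h1)
    simp [Matrix.mulVec, dotProduct, Fin.sum_univ_two, Mα, Mβ]
    ring
  · refine (congrArg norm ?_).trans_le (key a (v 1) (v 0) (v 1) rfl h1 h0 h1)
    simp [Matrix.mulVec, dotProduct, Fin.sum_univ_two, Mα, Mβ]
    ring

/-- The remainder kernel in the expansion of the resolvent, in terms of Taylor remainders of the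
exponential. -/
lemma Kker_sub_sub_A1ker {m : ℝ} {ω k : ℂ} (hk : k ≠ 0) (z : ℝ) :
    Kker m ω k z - (Complex.I * m / (2 * k)) • ((1 : Matrix (Fin 2) (Fin 2) ℂ) + Mβ) - A1ker m z
      = (-(Complex.I / 2) * (Real.sign z : ℂ) *
            (Complex.exp (Complex.I * k * (|z| : ℝ)) - 1)) • Mα
        + (Complex.I * m / (2 * k) * (Complex.exp (Complex.I * k * (|z| : ℝ)) - 1
            - Complex.I * k * (|z| : ℝ))) • ((1 : Matrix (Fin 2) (Fin 2) ℂ) + Mβ)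
        + (Complex.I * Complex.exp (Complex.I * k * (|z| : ℝ)) / (2 * k) * (ω - m)) •
            (1 : Matrix (Fin 2) (Fin 2) ℂ) := by
  have hmz : (m : ℂ) / 2 * (|z| : ℝ) = -(Complex.I * m / (2 * k) * (Complex.I * k * (|z| : ℝ))) := by
    field_simp
    rw [Complex.I_sq]
    ring
  simp only [Kker, A1ker, neg_mul, hmz]
  module

/-- Pointwise bound on the action of the remainder kernel. -/
lemma norm_remainder_mulVec_le {m : ℝ} (hm : 0 < m) {ω k : ℂ} (hk : 0 < k.im) (z : ℝ)
    (v : Fin 2 → ℂ) :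
    ‖(Kker m ω k z - (Complex.I * m / (2 * k)) • ((1 : Matrix (Fin 2) (Fin 2) ℂ) + Mβ)
        - A1ker m z).mulVec v‖
      ≤ ((1 + 3 * m) * ‖k‖ + ‖ω - m‖ / ‖k‖) * (1 + z ^ 2) * ‖v‖ := by
  have hk0 : k ≠ 0 := by rintro rfl; simp at hk
  have hkn : 0 < ‖k‖ := norm_pos_iff.2 hk0
  rw [Kker_sub_sub_A1ker hk0]
  refine (norm_dirac_combination_mulVec_le _ _ _ _).trans ?_
  gcongr
  set w : ℂ := Complex.I * k * (|z| : ℝ) with hw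
  have hre : w.re ≤ 0 := by
    simp only [hw, Complex.mul_re, Complex.I_re, Complex.I_im, Complex.ofReal_re,
      Complex.ofReal_im, Complex.mul_im]
    nlinarith [mul_nonneg hk.le (abs_nonneg z)]
  have hwn : ‖w‖ = ‖k‖ * |z| := by simp [hw]
  have hexp : ‖Complex.exp w‖ ≤ 1 := by rw [Complex.norm_exp]; exact Real.exp_le_one_iff.2 hre
  have hsign : ‖(Real.sign z : ℂ)‖ ≤ 1 := by
    rcases Real.sign_apply_eq z with h | h | h <;> simp [h]
  have hz : |z| ≤ 1 + z ^ 2 := by nlinarith [sq_abs z, sq_nonneg (|z| - 1), abs_nonneg z]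
  have hA : ‖-(Complex.I / 2) * (Real.sign z : ℂ) * (Complex.exp w - 1)‖
      ≤ ‖k‖ * (1 + z ^ 2) := by
    calc _ = 1 / 2 * ‖(Real.sign z : ℂ)‖ * ‖Complex.exp w - 1‖ := by simp
      _ ≤ 1 / 2 * 1 * (2 * ‖w‖) := by
          gcongr
          exact norm_exp_sub_one_le_of_re_nonpos hre
      _ = ‖k‖ * |z| := by rw [hwn]; ring
      _ ≤ _ := by gcongr
  have hB : ‖Complex.I * m / (2 * k) * (Complex.exp w - 1 - w)‖
      ≤ 3 * m / 2 * ‖k‖ * (1 + z ^ 2) := by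
    calc _ = m / (2 * ‖k‖) * ‖Complex.exp w - 1 - w‖ := by simp [abs_of_pos hm]
      _ ≤ m / (2 * ‖k‖) * (3 * ‖w‖ ^ 2) := by
          gcongr
          exact norm_exp_sub_one_sub_id_le_of_re_nonpos hre
      _ = 3 * m / 2 * ‖k‖ * z ^ 2 := by rw [hwn, mul_pow, sq_abs]; field_simp
      _ ≤ _ := by gcongr; linarith
  have hC : ‖Complex.I * Complex.exp w / (2 * k) * (ω - m)‖
      ≤ ‖ω - m‖ / ‖k‖ * (1 + z ^ 2) := by
    calc _ = ‖Complex.exp w‖ * (‖ω - m‖ / ‖k‖) / 2 := by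
          simp only [norm_mul, norm_div, Complex.norm_I, one_mul, Complex.norm_two]
          field_simp
      _ ≤ 1 * (‖ω - m‖ / ‖k‖) / 1 := by gcongr; norm_num
      _ ≤ ‖ω - m‖ / ‖k‖ * (1 + z ^ 2) := by
          rw [one_mul, div_one]
          exact le_mul_of_one_le_right (by positivity) (by linarith [sq_nonneg z])
  linarith

/-- Near the spectral edge, `‖k‖` and `‖ω - m‖ / ‖k‖` are of size `‖ω - m‖ ^ (1/2)`. -/
lemma dirac_momentum_bound {m : ℝ} (hm : 0 < m) {ω k : ℂ} (hω : ‖ω - m‖ ≤ m)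
    (hk0 : k ≠ 0) (hk : k ^ 2 = ω ^ 2 - (m : ℂ) ^ 2) :
    (1 + 3 * m) * ‖k‖ + ‖ω - m‖ / ‖k‖
      ≤ ((1 + 3 * m) * √(3 * m) + 1 / √m) * ‖ω - m‖ ^ (1 / 2 : ℝ) := by
  rw [← Real.sqrt_eq_rpow]
  have hkn : 0 < ‖k‖ := norm_pos_iff.2 hk0
  have hsq : ‖k‖ ^ 2 = ‖ω - m‖ * ‖ω + m‖ := by
    rw [← norm_pow, hk, ← norm_mul]; congr 1; ring
  have h2m : ‖(2 * m : ℂ)‖ = 2 * m := by simp [abs_of_pos hm]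
  have hlow : m ≤ ‖ω + m‖ := by
    have := norm_sub_le (ω + m) (ω - m)
    rw [show ω + m - (ω - m) = (2 * m : ℂ) by ring, h2m] at this
    linarith
  have hup : ‖ω + m‖ ≤ 3 * m := by
    have := norm_add_le (ω - m) (2 * m : ℂ)
    rw [show ω - m + 2 * m = ω + m by ring, h2m] at this
    linarith
  have hk_le : ‖k‖ ≤ √(3 * m) * √‖ω - m‖ := by
    rw [← Real.sqrt_mul (by positivity)]
    refine Real.le_sqrt_of_sq_le ?_
    rw [hsq, mul_comm]
    gcongr
  have hk_ge : √m * √‖ω - m‖ ≤ ‖k‖ := by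
    rw [← Real.sqrt_mul hm.le]
    refine Real.sqrt_le_iff.2 ⟨hkn.le, ?_⟩
    rw [hsq, mul_comm]
    gcongr
  have hquot : ‖ω - m‖ / ‖k‖ ≤ 1 / √m * √‖ω - m‖ := by
    have hsm : 0 < √m := Real.sqrt_pos.2 hm
    rw [div_le_iff₀ hkn]
    calc ‖ω - m‖ = 1 / √m * √‖ω - m‖ * (√m * √‖ω - m‖) := by
          field_simp
          rw [Real.sq_sqrt (norm_nonneg _)]
      _ ≤ _ := by gcongr
  calc _ ≤ (1 + 3 * m) * (√(3 * m) * √‖ω - m‖) + 1 / √m * √‖ω - m‖ := by gcongr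
    _ = _ := by ring

/-- Weighted Cauchy–Schwarz inequality. -/
lemma lintegral_one_add_sq_mul_le (σ : ℝ) {g : ℝ → ℝ≥0∞} (hg : Measurable g) :
    ∫⁻ y : ℝ, ENNReal.ofReal (1 + y ^ 2) * g y
      ≤ (∫⁻ y : ℝ, ENNReal.ofReal ((1 + y ^ 2) ^ (2 - σ))) ^ (1 / 2 : ℝ) *
        (∫⁻ y : ℝ, ENNReal.ofReal ((1 + y ^ 2) ^ σ) * g y ^ 2) ^ (1 / 2 : ℝ) := by
  have hpos : ∀ y : ℝ, 0 < 1 + y ^ 2 := fun y => by positivity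
  have hmeas : ∀ s : ℝ, Measurable fun y : ℝ => ENNReal.ofReal ((1 + y ^ 2) ^ s) := fun s => by
    fun_prop
  have h := ENNReal.lintegral_mul_le_Lp_mul_Lq (volume : Measure ℝ) Real.HolderConjugate.two_two
    (f := fun y => ENNReal.ofReal ((1 + y ^ 2) ^ (1 - σ / 2)))
    (g := fun y => ENNReal.ofReal ((1 + y ^ 2) ^ (σ / 2)) * g y)
    (hmeas _).aemeasurable ((hmeas _).mul hg).aemeasurable
  have hpow : ∀ s y : ℝ, ENNReal.ofReal ((1 + y ^ 2) ^ s) ^ 2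
      = ENNReal.ofReal ((1 + y ^ 2) ^ (2 * s)) := fun s y => by
    rw [← ENNReal.ofReal_pow (Real.rpow_nonneg (hpos y).le _), ← Real.rpow_mul_natCast (hpos y).le]
    congr 2
    push_cast
    ring
  simp only [Pi.mul_apply, ENNReal.rpow_two, mul_pow, hpow] at h
  rw [show 2 * (1 - σ / 2) = 2 - σ by ring, show 2 * (σ / 2) = σ by ring] at h
  refine (lintegral_congr fun y => ?_).trans_le h
  rw [← mul_assoc, ← ENNReal.ofReal_mul (Real.rpow_nonneg (hpos y).le _), ← Real.rpow_add (hpos y)]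
  norm_num

/-- Powers of `1 + y²` below the exponent `-1/2` have finite integral. -/
lemma lintegral_one_add_sq_rpow_lt_top {s : ℝ} (hs : s < -(1 / 2)) :
    ∫⁻ y : ℝ, ENNReal.ofReal ((1 + y ^ 2) ^ s) < ∞ := by
  have h := integrable_rpow_neg_one_add_norm_sq (E := ℝ) (μ := volume) (r := -(2 * s))
    (by simp; linarith)
  have h2 : Integrable fun y : ℝ => (1 + y ^ 2) ^ s := by
    convert h using 3 with y
    · simp
    · ring
  exact h2.lintegral_lt_top

/-- An operator whose kernel is dominated by `B (1 + (x - y)²)` is bounded between weighted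
`L²` spaces. -/
lemma weighted_lintegral_integral_le_of_norm_le {E F : Type*} [NormedAddCommGroup E] [MeasurableSpace E]
    [OpensMeasurableSpace E] [NormedAddCommGroup F] [NormedSpace ℝ F] (σ B : ℝ)
    {f : ℝ → E} (hf : Measurable f) {T : ℝ → ℝ → F}
    (hT : ∀ x y, ‖T x y‖ ≤ B * (1 + (x - y) ^ 2) * ‖f y‖) (hB : 0 ≤ B) :
    (∫⁻ x : ℝ, ENNReal.ofReal ((1 + x ^ 2) ^ (-σ)) *
        (‖∫ y : ℝ, T x y‖₊ : ℝ≥0∞) ^ 2) ^ (1 / 2 : ℝ)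
      ≤ ENNReal.ofReal (2 * B) * (∫⁻ y : ℝ, ENNReal.ofReal ((1 + y ^ 2) ^ (2 - σ))) *
        (∫⁻ y : ℝ, ENNReal.ofReal ((1 + y ^ 2) ^ σ) * (‖f y‖₊ : ℝ≥0∞) ^ 2) ^ (1 / 2 : ℝ) := by
  set J := ∫⁻ y : ℝ, ENNReal.ofReal ((1 + y ^ 2) ^ (2 - σ)) with hJ
  set N := (∫⁻ y : ℝ, ENNReal.ofReal ((1 + y ^ 2) ^ σ) * (‖f y‖₊ : ℝ≥0∞) ^ 2) ^ (1 / 2 : ℝ)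
  have hpos : ∀ y : ℝ, 0 < 1 + y ^ 2 := fun y => by positivity
  have hpt : ∀ x y, ‖T x y‖ₑ ≤ ENNReal.ofReal (2 * B) * ENNReal.ofReal (1 + x ^ 2) *
      (ENNReal.ofReal (1 + y ^ 2) * ‖f y‖ₑ) := by
    intro x y
    rw [← ofReal_norm, ← ofReal_norm, ← ENNReal.ofReal_mul (by positivity),
      ← ENNReal.ofReal_mul (by positivity), ← ENNReal.ofReal_mul (by positivity)]
    refine ENNReal.ofReal_le_ofReal ((hT x y).trans ?_)
    have : 1 + (x - y) ^ 2 ≤ 2 * (1 + x ^ 2) * (1 + y ^ 2) := by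
      nlinarith [sq_nonneg (x + y), mul_nonneg (sq_nonneg x) (sq_nonneg y)]
    calc _ ≤ B * (2 * (1 + x ^ 2) * (1 + y ^ 2)) * ‖f y‖ := by gcongr
      _ = _ := by ring
  have hT_int : ∀ x, ‖∫ y : ℝ, T x y‖ₑ
      ≤ ENNReal.ofReal (2 * B) * ENNReal.ofReal (1 + x ^ 2) * (J ^ (1 / 2 : ℝ) * N) := by
    intro x
    calc ‖∫ y : ℝ, T x y‖ₑ ≤ ∫⁻ y, ‖T x y‖ₑ := enorm_integral_le_lintegral_enorm _
      _ ≤ ∫⁻ y, ENNReal.ofReal (2 * B) * ENNReal.ofReal (1 + x ^ 2) *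
            (ENNReal.ofReal (1 + y ^ 2) * ‖f y‖ₑ) := lintegral_mono (hpt x)
      _ = ENNReal.ofReal (2 * B) * ENNReal.ofReal (1 + x ^ 2) *
            ∫⁻ y, ENNReal.ofReal (1 + y ^ 2) * ‖f y‖ₑ :=
          lintegral_const_mul' _ _ (ENNReal.mul_ne_top ENNReal.ofReal_ne_top ENNReal.ofReal_ne_top)
      _ ≤ _ := by
          gcongr
          exact lintegral_one_add_sq_mul_le σ hf.enorm
  have houter : ∫⁻ x : ℝ, ENNReal.ofReal ((1 + x ^ 2) ^ (-σ)) * (‖∫ y : ℝ, T x y‖₊ : ℝ≥0∞) ^ 2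
      ≤ J * (ENNReal.ofReal (2 * B) * (J ^ (1 / 2 : ℝ) * N)) ^ 2 := by
    rw [hJ, ← lintegral_mul_const _ (by fun_prop)]
    refine lintegral_mono fun x => ?_
    calc ENNReal.ofReal ((1 + x ^ 2) ^ (-σ)) * (‖∫ y : ℝ, T x y‖₊ : ℝ≥0∞) ^ 2
        ≤ ENNReal.ofReal ((1 + x ^ 2) ^ (-σ)) *
          (ENNReal.ofReal (2 * B) * ENNReal.ofReal (1 + x ^ 2) * (J ^ (1 / 2 : ℝ) * N)) ^ 2 := by
          gcongr
          exact hT_int x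
      _ = ENNReal.ofReal ((1 + x ^ 2) ^ (-σ)) * ENNReal.ofReal (1 + x ^ 2) ^ 2 *
          (ENNReal.ofReal (2 * B) * (J ^ (1 / 2 : ℝ) * N)) ^ 2 := by ring
      _ = _ := by
          rw [← ENNReal.ofReal_pow (hpos x).le,
            ← ENNReal.ofReal_mul (Real.rpow_nonneg (hpos x).le _),
            ← Real.rpow_add_natCast (hpos x).ne']
          congr 3
          push_cast
          ring_nf
  have hhalf : ∀ a : ℝ≥0∞, (a ^ 2) ^ (1 / 2 : ℝ) = a := fun a => by
    rw [← ENNReal.rpow_two, ← ENNReal.rpow_mul]; norm_num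
  have hJJ : J ^ (1 / 2 : ℝ) * J ^ (1 / 2 : ℝ) = J := by
    rw [← sq, ← ENNReal.rpow_two, ← ENNReal.rpow_mul]; norm_num
  calc _ ≤ (J * (ENNReal.ofReal (2 * B) * (J ^ (1 / 2 : ℝ) * N)) ^ 2) ^ (1 / 2 : ℝ) := by
        gcongr
    _ = ENNReal.ofReal (2 * B) * (J ^ (1 / 2 : ℝ) * J ^ (1 / 2 : ℝ)) * N := by
        rw [ENNReal.mul_rpow_of_nonneg _ _ (by norm_num), hhalf]; ring
    _ = _ := by rw [hJJ]

/-- Low-energy expansion of the free 1D Dirac resolvent at the spectral edge `ω = m`: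
for `m > 0` and `σ > 5/2`, the integral operator with kernel
`K_ω(x−y) − im(I+β)/(2k) − A₁(x−y)` (with `ω² − m² ∉ [0,∞)`, `0 < |ω−m| ≤ δ`,
`k² = ω² − m²`, `Im k > 0`) is bounded from `L²_σ(ℝ;ℂ²)` to `L²_{−σ}(ℝ;ℂ²)` with
operator norm at most `C|ω−m|^{1/2}`. -/
theorem free_dirac_resolvent_low_energy_expansion (m : ℝ) (hm : 0 < m)
    (σ : ℝ) (hσ : 5 / 2 < σ) :
    ∃ C : ℝ, 0 < C ∧ ∃ δ : ℝ, 0 < δ ∧ ∀ ω k : ℂ,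
      (∀ r : ℝ, 0 ≤ r → ω ^ 2 - (m : ℂ) ^ 2 ≠ (r : ℂ)) → ‖ω - (m : ℂ)‖ ≤ δ →
      k ^ 2 = ω ^ 2 - (m : ℂ) ^ 2 → 0 < k.im →
      ∀ f : ℝ → Fin 2 → ℂ, Measurable f →
        (∫⁻ x : ℝ, ENNReal.ofReal ((1 + x ^ 2) ^ (-σ)) *
            (‖∫ y : ℝ, (Kker m ω k (x - y)
                - (Complex.I * m / (2 * k)) • ((1 : Matrix (Fin 2) (Fin 2) ℂ) + Mβ)
                - A1ker m (x - y)).mulVec (f y)‖₊ : ℝ≥0∞) ^ 2) ^ (1 / 2 : ℝ)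
          ≤ ENNReal.ofReal (C * ‖ω - (m : ℂ)‖ ^ (1 / 2 : ℝ)) *
            (∫⁻ y : ℝ, ENNReal.ofReal ((1 + y ^ 2) ^ σ) * (‖f y‖₊ : ℝ≥0∞) ^ 2) ^ (1 / 2 : ℝ) := by
  set J := ∫⁻ y : ℝ, ENNReal.ofReal ((1 + y ^ 2) ^ (2 - σ)) with hJ
  have hJtop : J < ∞ := lintegral_one_add_sq_rpow_lt_top (by linarith)
  set D := (1 + 3 * m) * √(3 * m) + 1 / √m
  have hDpos : 0 < D := by positivity
  refine ⟨2 * D * (J.toReal + 1), by positivity, m, hm, ?_⟩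
  intro ω k _ hω hk hkim f hf
  have hk0 : k ≠ 0 := by rintro rfl; simp at hkim
  have hs : 0 ≤ ‖ω - (m : ℂ)‖ ^ (1 / 2 : ℝ) := by positivity
  refine (weighted_lintegral_integral_le_of_norm_le σ (D * ‖ω - (m : ℂ)‖ ^ (1 / 2 : ℝ)) hf
    (fun x y => ?_) (by positivity)).trans ?_
  · refine (norm_remainder_mulVec_le hm hkim (x - y) (f y)).trans ?_
    gcongr
    exact dirac_momentum_bound hm hω hk0 hk
  · gcongr
    nth_rewrite 1 [← hJ, ← ENNReal.ofReal_toReal hJtop.ne]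
    rw [← ENNReal.ofReal_mul (by positivity)]
    refine ENNReal.ofReal_le_ofReal ?_
    nlinarith [mul_nonneg hDpos.le hs]
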